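/- Let L > 0 and for 0 < G < L set e(L,G) := √(1 − G²/L²). Then ∂e/∂G (L,G) = −G/(e(L,G)·L²) = (e(L,G)² − 1)/(e(L,G)·G). Consequently, if V : [0,1) × ℝ → ℝ is a C¹ branch of the true anomaly (V(0,ℓ) = ℓ, cos V = C, sin V = S), then for fixed L and ℓ the function W(G) := V(e(L,G), ℓ) satisfies ∂W/∂G = −(sin(W)/(e·G))·(2 + e·cos(W)), where e = e(L,G). -/

import Mathlib

/-- `C(e,ℓ) = (cos(u(e,ℓ)) − e)/(1 − e·cos(u(e,ℓ)))`, the cosine of the true anomaly. -/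
noncomputable def Cfun (U : ℝ → ℝ → ℝ) (e ℓ : ℝ) : ℝ :=
  (Real.cos (U e ℓ) - e) / (1 - e * Real.cos (U e ℓ))

/-- `S(e,ℓ) = √(1−e²)·sin(u(e,ℓ))/(1 − e·cos(u(e,ℓ)))`, the sine of the true anomaly. -/
noncomputable def Sfun (U : ℝ → ℝ → ℝ) (e ℓ : ℝ) : ℝ :=
  Real.sqrt (1 - e ^ 2) * Real.sin (U e ℓ) / (1 - e * Real.cos (U e ℓ))

theorem aux_pos (e x : ℝ) (h0 : 0 ≤ e) (h1 : e < 1) :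
    0 < 1 - e * Real.cos x ∧ 0 < 1 + e * Real.cos x := by
  have a := Real.cos_le_one x
  have b := Real.neg_one_le_cos x
  constructor <;> nlinarith

theorem aux_alg (e c s q C S d : ℝ) (hd : d = 1 - e * c) (hd0 : d ≠ 0) (hq0 : q ≠ 0)
    (hs : s ^ 2 = 1 - c ^ 2) (hq : q ^ 2 = 1 - e ^ 2)
    (hC : C = (c - e) / d) (hS : S = q * s / d) :
    C * (((-e / q * s + q * (c * (s / d))) * d - q * s * (-c + e * (s * (s / d)))) / d ^ 2)
      - S * (((-(s * (s / d)) - 1) * d - (c - e) * (-c + e * (s * (s / d)))) / d ^ 2)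
      = S * (2 + e * C) / q ^ 2 := by
  have h1 : ((-(s * (s / d)) - 1) * d - (c - e) * (-c + e * (s * (s / d)))) / d ^ 2
      = - s ^ 2 * (q ^ 2 + d) / d ^ 3 := by
    field_simp
    rw [hq, hs, hd]; ring_nf
  have h2 : ((-e / q * s + q * (c * (s / d))) * d - q * s * (-c + e * (s * (s / d)))) / d ^ 2
      = s * (c - e) * (q ^ 2 + d) / (q * d ^ 3) := by
    field_simp
    subst hd
    grind
  rw [h1, h2, hS, hC]
  have h3 : (c - e) ^ 2 + q ^ 2 * s ^ 2 = d ^ 2 := by rw [hq, hs, hd]; ring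
  have h4 : 2 * d + e * (c - e) = q ^ 2 + d := by rw [hq, hd]; ring
  field_simp
  linear_combination s * (q ^ 2 + d) * h3 - d ^ 2 * s * h4

theorem aux_V (U : ℝ → ℝ → ℝ)
    (hU : ∀ e ∈ Set.Ico (0:ℝ) 1, ∀ ℓ : ℝ, U e ℓ - e * Real.sin (U e ℓ) = ℓ)
    (V : ℝ → ℝ → ℝ)
    (hV : ContDiffOn ℝ 1 (fun p : ℝ × ℝ => V p.1 p.2)
      (Set.Ico (0:ℝ) 1 ×ˢ (Set.univ : Set ℝ)))
    (hVcs : ∀ e ∈ Set.Ico (0:ℝ) 1, ∀ ℓ : ℝ,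
      Real.cos (V e ℓ) = Cfun U e ℓ ∧ Real.sin (V e ℓ) = Sfun U e ℓ)
    (ℓ e : ℝ) (h0 : 0 < e) (h1 : e < 1) :
    HasDerivAt (fun e => V e ℓ)
      (Real.sin (V e ℓ) * (2 + e * Real.cos (V e ℓ)) / (1 - e ^ 2)) e := by
  have hnhds : Set.Ico (0:ℝ) 1 ∈ nhds e := Ico_mem_nhds h0 h1
  have hdV : DifferentiableAt ℝ (fun e => V e ℓ) e := by
    have hA : DifferentiableAt ℝ (fun p : ℝ × ℝ => V p.1 p.2) (e, ℓ) :=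
      (hV.contDiffAt (prod_mem_nhds hnhds Filter.univ_mem)).differentiableAt (by norm_num)
    have hB : DifferentiableAt ℝ (fun x : ℝ => (x, ℓ)) e := by fun_prop
    exact DifferentiableAt.comp (g := fun p : ℝ × ℝ => V p.1 p.2) e hA hB
  have hq : 0 < 1 - e ^ 2 := by nlinarith
  have hqs := Real.sq_sqrt hq.le
  have hq0 : Real.sqrt (1 - e ^ 2) ≠ 0 := (Real.sqrt_pos.mpr hq).ne'
  have hdq : HasDerivAt (fun x : ℝ => Real.sqrt (1 - x ^ 2)) (-e / Real.sqrt (1 - e ^ 2)) e := by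
    have := ((hasDerivAt_pow 2 e).const_sub 1).sqrt hq.ne'
    refine this.congr_deriv ?_
    simp
    field_simp
  have hsinU : ∀ x ∈ Set.Ico (0:ℝ) 1, Real.sin (U x ℓ)
      = Real.sqrt (1 - x ^ 2) * Real.sin (V x ℓ) / (1 + x * Real.cos (V x ℓ)) := by
    intro x hx
    have p1 := (aux_pos x (U x ℓ) hx.1 hx.2).1
    have p2 := (aux_pos x (V x ℓ) hx.1 hx.2).2
    have hqx : 0 < 1 - x ^ 2 := by nlinarith [hx.1, hx.2]
    have hqxs := Real.sq_sqrt hqx.le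
    obtain ⟨hc, hs⟩ := hVcs x hx ℓ
    have e2 : 1 + x * Real.cos (V x ℓ) = (1 - x ^ 2) / (1 - x * Real.cos (U x ℓ)) := by
      rw [hc, Cfun]; field_simp; ring
    rw [e2, hs, Sfun]
    field_simp
    rw [hqxs]
  have hdU : DifferentiableAt ℝ (fun x => U x ℓ) e := by
    have hev : (fun x => U x ℓ) =ᶠ[nhds e] fun x => ℓ + x *
        (Real.sqrt (1 - x ^ 2) * Real.sin (V x ℓ) / (1 + x * Real.cos (V x ℓ))) := by
      filter_upwards [hnhds] with x hx
      have := hU x hx ℓ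
      rw [← hsinU x hx]; linarith
    refine DifferentiableAt.congr_of_eventuallyEq ?_ hev
    have p2 := (aux_pos e (V e ℓ) h0.le h1).2.ne'
    have := hdq.differentiableAt
    fun_prop (disch := assumption)
  have p1 := (aux_pos e (U e ℓ) h0.le h1).1.ne'
  obtain ⟨u', hu'⟩ : ∃ u', HasDerivAt (fun x => U x ℓ) u' e := ⟨_, hdU.hasDerivAt⟩
  obtain ⟨v', hv'⟩ : ∃ v', HasDerivAt (fun x => V x ℓ) v' e := ⟨_, hdV.hasDerivAt⟩
  have hid := hasDerivAt_id' e
  have hueq : u' = Real.sin (U e ℓ) / (1 - e * Real.cos (U e ℓ)) := by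
    have hK := hu'.sub (hid.mul hu'.sin)
    have hK2 : HasDerivAt ((fun x => U x ℓ) - (fun x => x) * fun x => Real.sin (U x ℓ)) 0 e := by
      refine (hasDerivAt_const e ℓ).congr_of_eventuallyEq ?_
      filter_upwards [hnhds] with x hx
      exact hU x hx ℓ
    have := hK.unique hK2
    rw [eq_div_iff p1]; linarith
  have hev := hVcs e ⟨h0.le, h1⟩ ℓ
  have hden := (hid.mul hu'.cos).const_sub 1
  have hCd := (hu'.cos.sub hid).div hden p1
  have hSd := (hdq.mul hu'.sin).div hden p1
  have hc := hv'.cos.unique (hCd.congr_of_eventuallyEq (by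
    filter_upwards [hnhds] with x hx
    exact (hVcs x hx ℓ).1))
  have hs := hv'.sin.unique (hSd.congr_of_eventuallyEq (by
    filter_upwards [hnhds] with x hx
    exact (hVcs x hx ℓ).2))
  have key := aux_alg e (Real.cos (U e ℓ)) (Real.sin (U e ℓ)) (Real.sqrt (1 - e ^ 2))
    (Real.cos (V e ℓ)) (Real.sin (V e ℓ)) (1 - e * Real.cos (U e ℓ)) rfl p1 hq0
    (by linarith [Real.sin_sq_add_cos_sq (U e ℓ)]) hqs hev.1 hev.2
  rw [hqs, ← hueq] at key
  have hv : v' = Real.cos (V e ℓ) * (Real.cos (V e ℓ) * v')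
      - Real.sin (V e ℓ) * (-Real.sin (V e ℓ) * v') := by
    linear_combination (-v') * Real.sin_sq_add_cos_sq (V e ℓ)
  rw [hc, hs] at hv
  convert hv' using 1
  rw [← key, hv]
  simp only [Pi.mul_apply, Pi.sub_apply]
  ring

/-- For `L > 0` and `0 < G < L`, with `e(L,G) = √(1 − G²/L²)`:
`∂e/∂G = −G/(e·L²) = (e² − 1)/(e·G)`; and if `V` is a `C¹` branch of the true
anomaly, then `W(G) := V(e(L,G), ℓ)` satisfies
`∂W/∂G = −(sin W/(e·G))·(2 + e·cos W)`. -/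
theorem stmt_7 (U : ℝ → ℝ → ℝ)
    (hU : ∀ e ∈ Set.Ico (0:ℝ) 1, ∀ ℓ : ℝ, U e ℓ - e * Real.sin (U e ℓ) = ℓ)
    (V : ℝ → ℝ → ℝ)
    (hV : ContDiffOn ℝ 1 (fun p : ℝ × ℝ => V p.1 p.2)
      (Set.Ico (0:ℝ) 1 ×ˢ (Set.univ : Set ℝ)))
    (hV0 : ∀ ℓ : ℝ, V 0 ℓ = ℓ)
    (hVcs : ∀ e ∈ Set.Ico (0:ℝ) 1, ∀ ℓ : ℝ,
      Real.cos (V e ℓ) = Cfun U e ℓ ∧ Real.sin (V e ℓ) = Sfun U e ℓ)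
    (L G : ℝ) (hL : 0 < L) (hG : 0 < G) (hGL : G < L) (ℓ : ℝ) :
    HasDerivAt (fun G' : ℝ => Real.sqrt (1 - G' ^ 2 / L ^ 2))
      (-G / (Real.sqrt (1 - G ^ 2 / L ^ 2) * L ^ 2)) G ∧
    -G / (Real.sqrt (1 - G ^ 2 / L ^ 2) * L ^ 2)
      = (Real.sqrt (1 - G ^ 2 / L ^ 2) ^ 2 - 1)
          / (Real.sqrt (1 - G ^ 2 / L ^ 2) * G) ∧
    HasDerivAt (fun G' : ℝ => V (Real.sqrt (1 - G' ^ 2 / L ^ 2)) ℓ)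
      (-(Real.sin (V (Real.sqrt (1 - G ^ 2 / L ^ 2)) ℓ)
            / (Real.sqrt (1 - G ^ 2 / L ^ 2) * G))
        * (2 + Real.sqrt (1 - G ^ 2 / L ^ 2)
            * Real.cos (V (Real.sqrt (1 - G ^ 2 / L ^ 2)) ℓ))) G := by
  have hLL : 0 < L ^ 2 := by positivity
  have hr : G ^ 2 / L ^ 2 < 1 := by rw [div_lt_one hLL]; nlinarith
  have hr0 : 0 < G ^ 2 / L ^ 2 := by positivity
  have hp : 0 < 1 - G ^ 2 / L ^ 2 := by linarith
  have hsq := Real.sq_sqrt hp.le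
  have he0 := Real.sqrt_pos.mpr hp
  have he1 : Real.sqrt (1 - G ^ 2 / L ^ 2) < 1 := by
    rw [Real.sqrt_lt' one_pos]; linarith
  have hd : HasDerivAt (fun G' : ℝ => Real.sqrt (1 - G' ^ 2 / L ^ 2))
      (-G / (Real.sqrt (1 - G ^ 2 / L ^ 2) * L ^ 2)) G := by
    have := (((hasDerivAt_pow 2 G).div_const (L ^ 2)).const_sub 1).sqrt hp.ne'
    refine this.congr_deriv ?_
    have hne := he0.ne'
    generalize Real.sqrt (1 - G ^ 2 / L ^ 2) = e at *
    norm_num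
    field_simp
  have hVd := aux_V U hU V hV hVcs ℓ _ he0 he1
  refine ⟨hd, ?_, ?_⟩
  · rw [hsq]; field_simp; ring
  · have := HasDerivAt.comp (h₂ := fun e => V e ℓ) G hVd hd
    refine this.congr_deriv ?_
    have hne := he0.ne'
    rw [hsq]
    generalize Real.sqrt (1 - G ^ 2 / L ^ 2) = e at *
    field_simp
    ring
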